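/- arXiv:1806.01469 — 2 statements merged into one kernel-verified Lean document; each statement's English description precedes it below -/
import Mathlib

section
/- For every integer n ≥ 3 and every vertex u ∈ V, the probability of the event E_{7,u} — that there exists a four-cycle rooted at u whose edge sequence pattern (writing s for a local edge and w for a long-range edge) is (w,s,s,w) — satisfies Pr(E_{7,u}) < (6·ζ(3) + 21/32) · ln(n/2)^{−2}. -/
open scoped Classical
open Finset

/-- Vertex set of the `n × n` torus. -/
abbrev Vx (n : ℕ) := Fin n × Fin n

/-- Toroidal distance on the `n × n` torus. -/
def tdist (n : ℕ) (u v : Vx n) : ℕ :=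
  min ((u.1 : ℤ) - (v.1 : ℤ)).natAbs (n - ((u.1 : ℤ) - (v.1 : ℤ)).natAbs) +
  min ((u.2 : ℤ) - (v.2 : ℤ)).natAbs (n - ((u.2 : ℤ) - (v.2 : ℤ)).natAbs)

/-- The normalizing factor at vertex `u`. -/
noncomputable def Zfac (n : ℕ) (u : Vx n) : ℝ :=
  (∑ w ∈ univ.filter (fun w => w ≠ u), ((tdist n u w : ℝ) ^ 2)⁻¹)⁻¹

/-- The probability mass of the outcome `c : V → V` (the vector of long-range choices)
under the UTSW product measure: each vertex `u` independently chooses `c u = v ≠ u`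
with probability `Z · d(u,v)⁻²`. -/
noncomputable def mass (n : ℕ) (c : Vx n → Vx n) : ℝ :=
  ∏ u : Vx n, if c u = u then 0 else Zfac n u * ((tdist n u (c u) : ℝ) ^ 2)⁻¹

/-- Probability of an event under the UTSW product measure. -/
noncomputable def Pr (n : ℕ) (E : Set (Vx n → Vx n)) : ℝ :=
  ∑ c : Vx n → Vx n, if c ∈ E then mass n c else 0

/-- `{x, y}` is an edge of the UTSW random graph `G(c)`. -/
def isEdge (n : ℕ) (c : Vx n → Vx n) (x y : Vx n) : Prop :=
  x ≠ y ∧ (tdist n x y = 1 ∨ c x = y ∨ c y = x)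

/-- `{x, y}` is an edge of `G(c)` of the given kind: local (`w = false`, distance one)
or long-range (`w = true`, distance not one). -/
def edgeKind (n : ℕ) (c : Vx n → Vx n) (x y : Vx n) (w : Bool) : Prop :=
  isEdge n c x y ∧ (tdist n x y = 1 ↔ w = false)

/-- There is a four-cycle rooted at `u` in `G(c)` whose edge sequence has the local/long-range
pattern `(p₁, p₂, p₃, p₄)` (`false` = local edge, `true` = long-range edge). -/
def cyclePat (n : ℕ) (c : Vx n → Vx n) (u : Vx n) (p₁ p₂ p₃ p₄ : Bool) : Prop :=
  ∃ a b e : Vx n, a ≠ b ∧ a ≠ e ∧ b ≠ e ∧ a ≠ u ∧ b ≠ u ∧ e ≠ u ∧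
    edgeKind n c u a p₁ ∧ edgeKind n c a b p₂ ∧ edgeKind n c b e p₃ ∧ edgeKind n c e u p₄

/-- `ζ(3) = ∑_{i ≥ 1} i⁻³`. -/
noncomputable def zeta3 : ℝ := ∑' i : ℕ, ((i + 1 : ℝ) ^ 3)⁻¹

/-- Distance of the residue `i` from `0` on the cycle of length `n`. -/
def foldDist (n i : ℕ) : ℕ := min i (n - i)

/-- Probability that the long-range contact of `x` is `y`. -/
noncomputable def stepProb (n : ℕ) (x y : Vx n) : ℝ :=
  if y = x then 0 else Zfac n x * ((tdist n x y : ℝ) ^ 2)⁻¹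

/-- The inverse squared distance, set to zero on neighbours. -/
noncomputable def farWeight (n : ℕ) (u v : Vx n) : ℝ :=
  if tdist n u v = 1 then 0 else ((tdist n u v : ℝ) ^ 2)⁻¹

/-- The nonzero sums of two unit vectors of the torus. -/
def twoStep (n : ℕ) [NeZero n] : Fin 8 → Vx n :=
  ![(1 + 1, 0), (-1 + -1, 0), (0, 1 + 1), (0, -1 + -1), (1, 1), (1, -1), (-1, 1), (-1, -1)]

section Distance

variable {n : ℕ}

theorem min_natAbs_sub_eq_foldDist (x y : Fin n) :
    min ((x : ℤ) - (y : ℤ)).natAbs (n - ((x : ℤ) - (y : ℤ)).natAbs) =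
      foldDist n (y - x).val := by
  have hx := x.isLt
  have hy := y.isLt
  unfold foldDist
  rcases le_or_gt x y with h | h
  · rw [Fin.coe_sub_iff_le.mpr h]
    have : x.val ≤ y.val := h
    omega
  · rw [Fin.coe_sub_iff_lt.mpr h]
    have : y.val < x.val := h
    omega

theorem tdist_eq_foldDist (u v : Vx n) :
    tdist n u v = foldDist n (v.1 - u.1).val + foldDist n (v.2 - u.2).val := by
  unfold tdist
  rw [min_natAbs_sub_eq_foldDist, min_natAbs_sub_eq_foldDist]

theorem tdist_comm (u v : Vx n) : tdist n u v = tdist n v u := by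
  unfold tdist
  rw [← Int.natAbs_neg ((u.1 : ℤ) - v.1), ← Int.natAbs_neg ((u.2 : ℤ) - v.2), neg_sub, neg_sub]

theorem tdist_self (u : Vx n) : tdist n u u = 0 := by simp [tdist]

theorem sub_eq_zero_of_foldDist [NeZero n] {x y : Fin n} (h : foldDist n (y - x).val = 0) :
    y = x := by
  have hlt := (y - x).isLt
  have h0 : (y - x).val = 0 := by unfold foldDist at h; omega
  exact sub_eq_zero.mp (Fin.ext (by simpa using h0))

theorem eq_add_one_of_foldDist [NeZero n] (hn : 3 ≤ n) {x y : Fin n}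
    (h : foldDist n (y - x).val = 1) : y = x + 1 ∨ y = x + -1 := by
  have hlt := (y - x).isLt
  have h1 : ((1 : Fin n) : ℕ) = 1 := by
    rw [Fin.val_one', Nat.mod_eq_of_lt (by omega)]
  have h2 : (y - x).val = 1 ∨ (y - x).val = n - 1 := by unfold foldDist at h; omega
  rcases h2 with h2 | h2
  · left
    rw [← sub_eq_iff_eq_add']
    exact Fin.ext (h2.trans h1.symm)
  · right
    rw [← sub_eq_iff_eq_add']
    refine Fin.ext ?_
    rw [h2, Fin.val_neg', h1, Nat.mod_eq_of_lt (by omega)]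

theorem neighbour_cases [NeZero n] (hn : 3 ≤ n) {x y : Vx n} (h : tdist n x y = 1) :
    y = x + (1, 0) ∨ y = x + (-1, 0) ∨ y = x + (0, 1) ∨ y = x + (0, -1) := by
  rw [tdist_eq_foldDist] at h
  have h' : (foldDist n (y.1 - x.1).val = 0 ∧ foldDist n (y.2 - x.2).val = 1) ∨
      (foldDist n (y.1 - x.1).val = 1 ∧ foldDist n (y.2 - x.2).val = 0) := by omega
  rcases h' with ⟨h1, h2⟩ | ⟨h1, h2⟩
  · have e1 := sub_eq_zero_of_foldDist h1
    rcases eq_add_one_of_foldDist hn h2 with e2 | e2 <;> simp [Prod.ext_iff, e1, e2]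
  · have e1 := sub_eq_zero_of_foldDist h2
    rcases eq_add_one_of_foldDist hn h1 with e2 | e2 <;> simp [Prod.ext_iff, e1, e2]

theorem exists_twoStep [NeZero n] (hn : 3 ≤ n) {a b e : Vx n} (hab : tdist n a b = 1)
    (hbe : tdist n b e = 1) (hae : a ≠ e) : ∃ k, e = a + twoStep n k := by
  have step : ∀ d d' : Vx n, (d + d' = 0 ∨ ∃ k, d + d' = twoStep n k) →
      b = a + d → e = b + d' → ∃ k, e = a + twoStep n k := by
    rintro d d' (h | ⟨k, h⟩) rfl rfl
    · exact absurd (by rw [add_assoc, h, add_zero]) hae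
    · exact ⟨k, by rw [add_assoc, h]⟩
  rcases neighbour_cases hn hab with h | h | h | h <;>
  rcases neighbour_cases hn hbe with h' | h' | h' | h' <;>
  refine step _ _ ?_ h h' <;>
  simp [twoStep, Fin.exists_fin_succ]

end Distance

section Sums

variable {n : ℕ}

theorem sum_foldDist_sub [NeZero n] (h : ℕ → ℝ) (x : Fin n) :
    ∑ y : Fin n, h (foldDist n (y - x).val) = ∑ i ∈ range n, h (foldDist n i) := by
  rw [← Fin.sum_univ_eq_sum_range (fun i => h (foldDist n i))]
  exact Equiv.sum_comp (Equiv.subRight x) (fun y : Fin n => h (foldDist n y.val))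

theorem sum_foldDist_prod [NeZero n] (F : ℕ → ℕ → ℝ) (u : Vx n) :
    ∑ v : Vx n, F (foldDist n (v.1 - u.1).val) (foldDist n (v.2 - u.2).val) =
      ∑ i ∈ range n, ∑ j ∈ range n, F (foldDist n i) (foldDist n j) := by
  rw [Fintype.sum_prod_type]
  refine Eq.trans (sum_congr rfl fun x _ => ?_)
    (sum_foldDist_sub (fun p => ∑ j ∈ range n, F p (foldDist n j)) u.1)
  exact sum_foldDist_sub (fun q => F (foldDist n (x - u.1).val) q) u.2

theorem sum_foldDist_le {h : ℕ → ℝ} (h0 : ∀ i, 0 ≤ h i) (hn : 0 < n) :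
    ∑ i ∈ range n, h (foldDist n i) ≤ h 0 + 2 * ∑ i ∈ range (n - 1), h (i + 1) := by
  obtain ⟨m, rfl⟩ : ∃ m, n = m + 1 := ⟨n - 1, by omega⟩
  rw [sum_range_succ', Nat.add_sub_cancel]
  have hz : foldDist (m + 1) 0 = 0 := by simp [foldDist]
  have hle : ∀ i ∈ range m, h (foldDist (m + 1) (i + 1)) ≤ h (i + 1) + h (m - 1 - i + 1) := by
    intro i hi
    have hi := mem_range.mp hi
    have e : m + 1 - (i + 1) = m - 1 - i + 1 := by omega
    rw [foldDist, e]
    rcases min_choice (i + 1) (m - 1 - i + 1) with h' | h' <;> rw [h']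
    · linarith [h0 (m - 1 - i + 1)]
    · linarith [h0 (i + 1)]
  have := sum_le_sum hle
  rw [sum_add_distrib, sum_range_reflect (fun i => h (i + 1))] at this
  rw [hz]
  linarith

theorem le_sum_foldDist {h : ℕ → ℝ} (h0 : ∀ i, 0 ≤ h i) {m : ℕ} (hm : 2 * m + 1 ≤ n) :
    h 0 + 2 * ∑ i ∈ range m, h (i + 1) ≤ ∑ i ∈ range n, h (foldDist n i) := by
  obtain ⟨k, hk⟩ : ∃ k, n = m + 1 + (m + k) := ⟨n - (2 * m + 1), by omega⟩
  have hs : ∑ i ∈ range n, h (foldDist n i) = ∑ i ∈ range (m + 1), h (foldDist n i) +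
      ∑ i ∈ range (m + k), h (foldDist n (m + 1 + i)) := by
    conv_lhs => rw [show range n = range (m + 1 + (m + k)) by rw [hk]]
    exact sum_range_add _ _ _
  have h1 : ∑ i ∈ range (m + 1), h (foldDist n i) = ∑ i ∈ range (m + 1), h i := by
    refine sum_congr rfl fun i hi => ?_
    have := mem_range.mp hi
    congr 1
    unfold foldDist
    omega
  have h2 : ∑ i ∈ range m, h (i + 1) ≤ ∑ i ∈ range (m + k), h (foldDist n (m + 1 + i)) := by
    rw [← sum_range_reflect (fun i => h (foldDist n (m + 1 + i)))]
    calc ∑ i ∈ range m, h (i + 1)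
        = ∑ i ∈ range m, h (foldDist n (m + 1 + (m + k - 1 - i))) := by
          refine sum_congr rfl fun i hi => ?_
          have := mem_range.mp hi
          congr 1
          unfold foldDist
          omega
      _ ≤ _ := sum_le_sum_of_subset_of_nonneg (range_mono (by omega)) fun _ _ _ => h0 _
  rw [hs, h1, sum_range_succ']
  linarith

theorem log_half_le_sum_inv {m : ℕ} (hn : 0 < n) (hm : n ≤ 2 * m + 2) :
    Real.log ((n : ℝ) / 2) ≤ ∑ k ∈ range m, ((k : ℝ) + 1)⁻¹ := by
  have h1 := log_add_one_le_harmonic m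
  have h2 : Real.log ((n : ℝ) / 2) ≤ Real.log ((m + 1 : ℕ) : ℝ) := by
    refine Real.log_le_log (by positivity) ?_
    have : (n : ℝ) ≤ 2 * m + 2 := by exact_mod_cast hm
    push_cast
    linarith
  refine h2.trans (h1.trans (le_of_eq ?_))
  simp [harmonic]

theorem sum_inv_le_double_sum (m : ℕ) :
    ∑ k ∈ range m, ((k : ℝ) + 1)⁻¹ ≤
      ∑ p ∈ range m, ∑ q ∈ range (m + 1), (((p + 1 + q : ℕ) : ℝ) ^ 2)⁻¹ := by
  calc ∑ k ∈ range m, ((k : ℝ) + 1)⁻¹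
      = ∑ k ∈ range m, ∑ p ∈ range (k + 1), (((p + 1 + (k - p) : ℕ) : ℝ) ^ 2)⁻¹ := by
        refine sum_congr rfl fun k _ => ?_
        rw [sum_congr rfl (g := fun _ => (((k : ℝ) + 1) ^ 2)⁻¹)]
        · rw [sum_const, card_range, nsmul_eq_mul]
          push_cast
          field_simp
        · intro p hp
          have := mem_range.mp hp
          rw [show p + 1 + (k - p) = k + 1 by omega]
          push_cast
          rfl
    _ = ∑ p ∈ range m, ∑ q ∈ range (m - p), (((p + 1 + q : ℕ) : ℝ) ^ 2)⁻¹ :=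
        sum_range_diag_flip m fun p q => (((p + 1 + q : ℕ) : ℝ) ^ 2)⁻¹
    _ ≤ _ := sum_le_sum fun p _ =>
        sum_le_sum_of_subset_of_nonneg (range_mono (by omega)) fun _ _ _ => by positivity

theorem four_mul_log_le_sum_tdist [NeZero n] (u : Vx n) :
    4 * Real.log ((n : ℝ) / 2) ≤ ∑ v : Vx n, ((tdist n u v : ℝ) ^ 2)⁻¹ := by
  have hn : 0 < n := Nat.pos_of_ne_zero (NeZero.ne n)
  set f : ℕ → ℝ := fun k => ((k : ℝ) ^ 2)⁻¹ with hf
  have f0 : ∀ k, 0 ≤ f k := fun k => by positivity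
  obtain ⟨m, hm1, hm2⟩ : ∃ m, 2 * m + 1 ≤ n ∧ n ≤ 2 * m + 2 := ⟨(n - 1) / 2, by omega, by omega⟩
  have hlog := (log_half_le_sum_inv hn hm2).trans (sum_inv_le_double_sum m)
  have hsum : ∑ v : Vx n, ((tdist n u v : ℝ) ^ 2)⁻¹ =
      ∑ i ∈ range n, ∑ j ∈ range n, f (foldDist n i + foldDist n j) := by
    rw [← sum_foldDist_prod (fun p q => f (p + q)) u]
    simp only [tdist_eq_foldDist, hf]
  have hin : ∀ p, f p + 2 * ∑ q ∈ range m, f (p + (q + 1)) ≤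
      ∑ j ∈ range n, f (p + foldDist n j) :=
    fun p => le_sum_foldDist (h := fun q => f (p + q)) (fun _ => f0 _) hm1
  have hout := le_sum_foldDist (h := fun p => ∑ j ∈ range n, f (p + foldDist n j))
    (fun _ => sum_nonneg fun _ _ => f0 _) hm1
  have hrow : ∑ p ∈ range m, (f (p + 1) + 2 * ∑ q ∈ range m, f (p + 1 + (q + 1))) ≤
      ∑ p ∈ range m, ∑ j ∈ range n, f (p + 1 + foldDist n j) := sum_le_sum fun p _ => hin (p + 1)
  have hzero := hin 0
  have hquad : ∑ p ∈ range m, ∑ q ∈ range (m + 1), (((p + 1 + q : ℕ) : ℝ) ^ 2)⁻¹ =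
      ∑ p ∈ range m, ∑ q ∈ range m, f (p + 1 + (q + 1)) + ∑ p ∈ range m, f (p + 1) := by
    rw [← sum_add_distrib]
    exact sum_congr rfl fun p _ => sum_range_succ' _ _
  have hf0 : f 0 = 0 := by simp [hf]
  rw [sum_add_distrib, ← mul_sum] at hrow
  simp only [zero_add, hf0] at hzero hout
  rw [hquad] at hlog
  rw [hsum]
  linarith

theorem sum_inv_sq_le (N : ℕ) :
    ∑ i ∈ range N, (((i + 1 : ℕ) : ℝ) + 1)⁻¹ ^ 2 ≤ 2 / 3 - ((N : ℝ) + 3 / 2)⁻¹ := by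
  induction N with
  | zero => norm_num
  | succ N ih =>
    rw [sum_range_succ]
    have : (((N + 1 : ℕ) : ℝ) + 1)⁻¹ ^ 2 ≤
        ((N : ℝ) + 3 / 2)⁻¹ - (((N + 1 : ℕ) : ℝ) + 3 / 2)⁻¹ := by
      push_cast
      rw [inv_sub_inv (by positivity) (by positivity), inv_pow, inv_eq_one_div,
        div_le_div_iff₀ (by positivity) (by positivity)]
      nlinarith
    linarith

theorem sum_foldDist_inv_sq_le (hn : 0 < n) :
    ∑ i ∈ range n, ((foldDist n i : ℝ) + 1)⁻¹ ^ 2 ≤ 7 / 3 := by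
  have h1 := sum_foldDist_le (h := fun i => ((i : ℝ) + 1)⁻¹ ^ 2) (fun _ => by positivity) hn
  have h2 := sum_inv_sq_le (n - 1)
  have h3 : (0 : ℝ) ≤ (((n - 1 : ℕ) : ℝ) + 3 / 2)⁻¹ := by positivity
  simp only [Nat.cast_zero, zero_add, inv_one, one_pow] at h1
  linarith

theorem inv_sq_add_sq_le {p q : ℕ} (h : 2 ≤ p + q) :
    ((((p + q : ℕ) : ℝ) ^ 2)⁻¹) ^ 2 ≤ ((p : ℝ) + 1)⁻¹ ^ 2 * ((q : ℝ) + 1)⁻¹ ^ 2 := by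
  rw [← mul_pow]
  refine pow_le_pow_left₀ (by positivity) ?_ 2
  rw [← mul_inv]
  refine inv_anti₀ (by positivity) ?_
  have h' : (2 : ℝ) ≤ p + q := by exact_mod_cast h
  push_cast
  nlinarith [sq_nonneg ((p : ℝ) - q)]

theorem farWeight_nonneg (u v : Vx n) : 0 ≤ farWeight n u v := by
  unfold farWeight
  split_ifs <;> positivity

theorem sum_farWeight_sq_le [NeZero n] (u : Vx n) :
    ∑ v, farWeight n u v ^ 2 ≤ 49 / 9 := by
  have hn : 0 < n := Nat.pos_of_ne_zero (NeZero.ne n)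
  set g : ℕ → ℝ := fun p => ((p : ℝ) + 1)⁻¹ ^ 2 with hg
  have g0 : ∀ p, 0 ≤ g p := fun p => by positivity
  have hle : ∀ v : Vx n, farWeight n u v ^ 2 ≤
      g (foldDist n (v.1 - u.1).val) * g (foldDist n (v.2 - u.2).val) := by
    intro v
    rw [farWeight, tdist_eq_foldDist]
    generalize foldDist n (v.1 - u.1).val = p
    generalize foldDist n (v.2 - u.2).val = q
    split_ifs with h
    · simpa using mul_nonneg (g0 p) (g0 q)
    · rcases Nat.lt_or_ge (p + q) 2 with h2 | h2
      · rw [show p + q = 0 by omega]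
        simpa using mul_nonneg (g0 p) (g0 q)
      · exact inv_sq_add_sq_le h2
  calc ∑ v, farWeight n u v ^ 2
      ≤ ∑ v : Vx n, g (foldDist n (v.1 - u.1).val) * g (foldDist n (v.2 - u.2).val) :=
        sum_le_sum fun v _ => hle v
    _ = (∑ i ∈ range n, g (foldDist n i)) * ∑ i ∈ range n, g (foldDist n i) := by
        rw [sum_foldDist_prod (fun p q => g p * g q) u, sum_mul_sum]
    _ ≤ 7 / 3 * (7 / 3) := by
        have := sum_foldDist_inv_sq_le hn
        exact mul_le_mul this this (sum_nonneg fun _ _ => g0 _) (by norm_num)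
    _ = 49 / 9 := by norm_num

theorem sum_farWeight_mul_shift_le [NeZero n] (u d : Vx n) :
    ∑ a, farWeight n u a * farWeight n u (a + d) ≤ 49 / 9 := by
  have hshift : ∑ a, farWeight n u (a + d) ^ 2 = ∑ a, farWeight n u a ^ 2 :=
    Equiv.sum_comp (Equiv.addRight d) fun a => farWeight n u a ^ 2
  have hle : ∑ a, farWeight n u a * farWeight n u (a + d) ≤
      ∑ a, (1 / 2 * farWeight n u a ^ 2 + 1 / 2 * farWeight n u (a + d) ^ 2) :=
    sum_le_sum fun a _ => by nlinarith [sq_nonneg (farWeight n u a - farWeight n u (a + d))]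
  rw [sum_add_distrib, ← mul_sum, ← mul_sum, hshift] at hle
  linarith [sum_farWeight_sq_le u]

end Sums

section Probability

variable {n : ℕ}

theorem Zfac_eq (u : Vx n) : Zfac n u = (∑ v, ((tdist n u v : ℝ) ^ 2)⁻¹)⁻¹ := by
  unfold Zfac
  rw [sum_filter_of_ne]
  rintro v - hv rfl
  simp [tdist_self] at hv

theorem Zfac_nonneg (u : Vx n) : 0 ≤ Zfac n u := by
  unfold Zfac
  positivity

theorem Zfac_le [NeZero n] (hL : 0 < Real.log ((n : ℝ) / 2)) (u : Vx n) :
    Zfac n u ≤ (4 * Real.log ((n : ℝ) / 2))⁻¹ := by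
  rw [Zfac_eq]
  exact inv_anti₀ (by positivity) (four_mul_log_le_sum_tdist u)

theorem stepProb_nonneg (x y : Vx n) : 0 ≤ stepProb n x y := by
  unfold stepProb
  have := Zfac_nonneg x
  split_ifs <;> positivity

theorem sum_stepProb_le_one (x : Vx n) : ∑ y, stepProb n x y ≤ 1 := by
  have : ∑ y, stepProb n x y = Zfac n x * ∑ y, ((tdist n x y : ℝ) ^ 2)⁻¹ := by
    rw [mul_sum]
    refine sum_congr rfl fun y _ => ?_
    unfold stepProb
    split_ifs with h
    · simp [h, tdist_self]
    · rfl
  rw [this, Zfac_eq]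
  exact inv_mul_le_one

theorem stepProb_le_farWeight [NeZero n] (hL : 0 < Real.log ((n : ℝ) / 2)) {x y : Vx n}
    (h : tdist n x y ≠ 1) :
    stepProb n x y ≤ (4 * Real.log ((n : ℝ) / 2))⁻¹ * farWeight n x y := by
  rw [farWeight, if_neg h, stepProb]
  split_ifs
  · positivity
  · exact mul_le_mul_of_nonneg_right (Zfac_le hL x) (by positivity)

theorem farWeight_comm (u v : Vx n) : farWeight n u v = farWeight n v u := by
  rw [farWeight, farWeight, tdist_comm]

theorem mass_nonneg (c : Vx n → Vx n) : 0 ≤ mass n c :=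
  prod_nonneg fun x _ => stepProb_nonneg x (c x)

theorem Pr_mono {E F : Set (Vx n → Vx n)} (h : E ⊆ F) : Pr n E ≤ Pr n F := by
  refine sum_le_sum fun c _ => ?_
  by_cases hE : c ∈ E
  · rw [if_pos hE, if_pos (h hE)]
  · rw [if_neg hE]
    split_ifs
    exacts [mass_nonneg c, le_rfl]

theorem Pr_empty : Pr n ∅ = 0 := by simp [Pr]

theorem Pr_union_le (E F : Set (Vx n → Vx n)) : Pr n (E ∪ F) ≤ Pr n E + Pr n F := by
  unfold Pr
  rw [← sum_add_distrib]
  refine sum_le_sum fun c _ => ?_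
  have := mass_nonneg c
  by_cases hE : c ∈ E <;> by_cases hF : c ∈ F <;> simp [hE, hF, this]

theorem Pr_iUnion_le {ι : Type*} [Fintype ι] (E : ι → Set (Vx n → Vx n)) :
    Pr n (⋃ i, E i) ≤ ∑ i, Pr n (E i) := by
  unfold Pr
  rw [sum_comm]
  refine sum_le_sum fun c _ => ?_
  have hnn : ∀ i ∈ univ, 0 ≤ if c ∈ E i then mass n c else 0 := fun i _ => by
    split_ifs
    exacts [mass_nonneg c, le_rfl]
  split_ifs with h
  · obtain ⟨i, hi⟩ := Set.mem_iUnion.mp h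
    exact (if_pos hi).ge.trans (single_le_sum hnn (mem_univ i))
  · exact sum_nonneg hnn

theorem Pr_two_choices_le {x x' : Vx n} (hx : x ≠ x') (y y' : Vx n) :
    Pr n {c | c x = y ∧ c x' = y'} ≤ stepProb n x y * stepProb n x' y' := by
  set t : Vx n → Finset (Vx n) := fun z => if z = x then {y} else if z = x' then {y'} else univ
    with ht
  have hmem : ∀ c : Vx n → Vx n, c ∈ Fintype.piFinset t ↔ c x = y ∧ c x' = y' := by
    intro c
    rw [Fintype.mem_piFinset]
    constructor
    · intro h
      have h1 := h x
      have h2 := h x'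
      simp only [ht, if_true, if_neg hx.symm, mem_singleton] at h1 h2
      exact ⟨h1, h2⟩
    · rintro ⟨h1, h2⟩ z
      simp only [ht]
      split_ifs with hz hz'
      · rw [hz, h1]; exact mem_singleton_self _
      · rw [hz', h2]; exact mem_singleton_self _
      · exact mem_univ _
  have hPr : Pr n {c | c x = y ∧ c x' = y'} = ∏ z, ∑ v ∈ t z, stepProb n z v := by
    rw [prod_univ_sum, ← univ_inter (Fintype.piFinset t), ← sum_ite_mem, Pr]
    refine sum_congr rfl fun c _ => ?_
    by_cases hc : c x = y ∧ c x' = y'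
    · rw [if_pos ((hmem c).mpr hc)]
      exact if_pos hc
    · rw [if_neg (mt (hmem c).mp hc)]
      exact if_neg hc
  rw [hPr]
  calc ∏ z, ∑ v ∈ t z, stepProb n z v
      ≤ ∏ z, (if z = x then stepProb n x y else 1) * (if z = x' then stepProb n x' y' else 1) := by
        refine prod_le_prod (fun z _ => sum_nonneg fun v _ => stepProb_nonneg z v) fun z _ => ?_
        by_cases hz : z = x
        · subst hz
          simp [ht, hx]
        · by_cases hz' : z = x'
          · subst hz'
            simp [ht, hz]
          · simpa [ht, hz, hz'] using sum_stepProb_le_one z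
    _ = stepProb n x y * stepProb n x' y' := by
        rw [prod_mul_distrib, prod_ite_eq' univ x, prod_ite_eq' univ x']
        simp

/-- The choices by which `a` and `e` are both joined to `u` by long-range edges,
the edge to `e` being chosen at `e`. -/
def longPair (n : ℕ) (u a e : Vx n) : Set (Vx n → Vx n) :=
  {c | a ≠ e ∧ a ≠ u ∧ e ≠ u ∧ tdist n u a ≠ 1 ∧ tdist n u e ≠ 1 ∧
    (c u = a ∨ c a = u) ∧ c e = u}

theorem Pr_longPair_le [NeZero n] (hL : 0 < Real.log ((n : ℝ) / 2)) (u a e : Vx n) :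
    Pr n (longPair n u a e) ≤
      2 * (4 * Real.log ((n : ℝ) / 2))⁻¹ ^ 2 * (farWeight n u a * farWeight n u e) := by
  set K := (4 * Real.log ((n : ℝ) / 2))⁻¹ with hK
  have K0 : 0 ≤ K := by positivity
  have wa := farWeight_nonneg u a
  have we := farWeight_nonneg u e
  by_cases h : a ≠ e ∧ a ≠ u ∧ e ≠ u ∧ tdist n u a ≠ 1 ∧ tdist n u e ≠ 1
  · obtain ⟨hae, -, heu, ha, he⟩ := h
    have hua := stepProb_le_farWeight hL ha
    have hau := stepProb_le_farWeight hL (tdist_comm u a ▸ ha)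
    have heu' := stepProb_le_farWeight hL (tdist_comm u e ▸ he)
    rw [← farWeight_comm] at hau heu'
    have hsub : longPair n u a e ⊆ {c | c u = a ∧ c e = u} ∪ {c | c a = u ∧ c e = u} := by
      rintro c ⟨-, -, -, -, -, h1 | h1, h2⟩
      exacts [Or.inl ⟨h1, h2⟩, Or.inr ⟨h1, h2⟩]
    have h1 := (Pr_two_choices_le (Ne.symm heu) a u).trans
      (mul_le_mul hua heu' (stepProb_nonneg _ _) (by positivity))
    have h2 := (Pr_two_choices_le hae u u).trans
      (mul_le_mul hau heu' (stepProb_nonneg _ _) (by positivity))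
    have h3 := (Pr_mono hsub).trans (Pr_union_le _ _)
    nlinarith
  · have : longPair n u a e = ∅ := by
      refine Set.eq_empty_of_forall_notMem fun c hc => h ?_
      obtain ⟨h1, h2, h3, h4, h5, -⟩ := hc
      exact ⟨h1, h2, h3, h4, h5⟩
    rw [this, Pr_empty]
    positivity

theorem cyclePat_subset_longPair [NeZero n] (hn : 3 ≤ n) (u : Vx n) :
    {c | cyclePat n c u true false false true} ⊆
      ⋃ k, ⋃ a, longPair n u a (a + twoStep n k) := by
  rintro c ⟨a, b, e, -, hae, -, hau, -, heu, ⟨⟨-, hua⟩, hua'⟩, ⟨-, hab⟩,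
    ⟨-, hbe⟩, ⟨-, heu'⟩, heu''⟩
  have hua' : tdist n u a ≠ 1 := fun h => by simpa using hua'.mp h
  have heu'' : tdist n e u ≠ 1 := fun h => by simpa using heu''.mp h
  have hue : tdist n u e ≠ 1 := tdist_comm e u ▸ heu''
  have hab := hab.mpr rfl
  have hbe := hbe.mpr rfl
  replace hua := hua.resolve_left hua'
  replace heu' := heu'.resolve_left heu''
  simp only [Set.mem_iUnion]
  by_cases hce : c e = u
  · obtain ⟨k, rfl⟩ := exists_twoStep hn hab hbe hae
    exact ⟨k, a, hae, hau, heu, hua', hue, hua, hce⟩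
  · have hcu : c u = e := heu'.resolve_left hce
    have hca : c a = u := hua.resolve_left fun h => hae (h.symm.trans hcu)
    rw [tdist_comm] at hab hbe
    obtain ⟨k, rfl⟩ := exists_twoStep hn hbe hab hae.symm
    exact ⟨k, e, hae.symm, heu, hau, hue, hua', Or.inl hcu, hca⟩

end Probability

theorem one_le_zeta3 : 1 ≤ zeta3 := by
  have hs : Summable fun i : ℕ => ((i + 1 : ℝ) ^ 3)⁻¹ := by
    have := (summable_nat_add_iff 1).mpr (Real.summable_nat_pow_inv (p := 3).mpr (by norm_num))
    simpa using this
  have := hs.le_tsum 0 fun i _ => by positivity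
  simpa [zeta3] using this

/-- Probability bound for the event `E7ᵤ`. -/
theorem prob_E7 :
    ∀ n : ℕ, 3 ≤ n → ∀ u : Vx n,
      Pr n {c | cyclePat n c u true false false true} <
        (6 * zeta3 + 21 / 32) * (Real.log ((n : ℝ) / 2) ^ 2)⁻¹ := by
  intro n hn u
  have : NeZero n := ⟨by omega⟩
  have hL : 0 < Real.log ((n : ℝ) / 2) := by
    have : (3 : ℝ) ≤ n := by exact_mod_cast hn
    exact Real.log_pos (by linarith)
  set L := Real.log ((n : ℝ) / 2) with hLdef
  have hbound : Pr n {c | cyclePat n c u true false false true} ≤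
      ∑ k : Fin 8, 2 * (4 * L)⁻¹ ^ 2 * (49 / 9) := by
    refine (Pr_mono (cyclePat_subset_longPair hn u)).trans ((Pr_iUnion_le _).trans ?_)
    refine sum_le_sum fun k _ => (Pr_iUnion_le _).trans ?_
    calc ∑ a, Pr n (longPair n u a (a + twoStep n k))
        ≤ ∑ a, 2 * (4 * L)⁻¹ ^ 2 * (farWeight n u a * farWeight n u (a + twoStep n k)) :=
          sum_le_sum fun a _ => Pr_longPair_le hL u a _
      _ ≤ 2 * (4 * L)⁻¹ ^ 2 * (49 / 9) := by
          rw [← mul_sum]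
          exact mul_le_mul_of_nonneg_left (sum_farWeight_mul_shift_le u _) (by positivity)
  have hconst : ∑ k : Fin 8, 2 * (4 * L)⁻¹ ^ 2 * (49 / 9) = 49 / 9 * (L ^ 2)⁻¹ := by
    rw [sum_const, card_univ, Fintype.card_fin, nsmul_eq_mul, mul_inv, mul_pow, inv_pow L]
    norm_num
    ring
  have hpos : 0 < (L ^ 2)⁻¹ := by positivity
  refine (hbound.trans_eq hconst).trans_lt (mul_lt_mul_of_pos_right ?_ hpos)
  linarith [one_le_zeta3]
end

section
/- For every integer n ≥ 3 and every vertex u ∈ V, the probability of the event E_{9,u} — that there exists a four-cycle rooted at u whose edge sequence pattern (writing s for a local edge and w for a long-range edge) is (w,w,w,w) — satisfies Pr(E_{9,u}) < ((3/4)·ζ(3) + 1/4) · (ln n + 1)² · ln(n/2)^{−4}. -/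
open scoped Classical
open Finset

namespace TorusSmallWorld

/-! ### Sphere sizes on the torus -/

/-- Distance between two coordinates on the cycle of length `n`. -/
def cycDist (n : ℕ) (x y : Fin n) : ℕ :=
  min ((x : ℤ) - (y : ℤ)).natAbs (n - ((x : ℤ) - (y : ℤ)).natAbs)

lemma tdist_eq (n : ℕ) (u v : Vx n) :
    tdist n u v = cycDist n u.1 v.1 + cycDist n u.2 v.2 := rfl

lemma cycDist_comm (n : ℕ) (x y : Fin n) : cycDist n x y = cycDist n y x := by
  unfold cycDist; omega

lemma tdist_comm (n : ℕ) (u v : Vx n) : tdist n u v = tdist n v u := by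
  rw [tdist_eq, tdist_eq, cycDist_comm, cycDist_comm n u.2]

lemma tdist_self (n : ℕ) (u : Vx n) : tdist n u u = 0 := by
  simp [tdist]

lemma tdist_le (n : ℕ) (u v : Vx n) : tdist n u v ≤ n := by
  unfold tdist; omega

/-- Number of points at distance `j` from a point of a long enough cycle. -/
def cycSphere (j : ℕ) : ℕ := if j = 0 then 1 else 2

lemma card_cycDist_le (n : ℕ) (x : Fin n) (j : ℕ) :
    #{y | cycDist n x y = j} ≤ cycSphere j := by
  have hx := x.isLt
  unfold cycSphere
  split_ifs with hj
  · refine Finset.card_le_one.2 fun y hy z hz => ?_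
    have := y.isLt
    have := z.isLt
    simp only [mem_filter, mem_univ, true_and] at hy hz
    unfold cycDist at hy hz
    ext
    omega
  · have h : (({y | cycDist n x y = j} : Finset (Fin n)).image Fin.val) ⊆
        {if (x : ℕ) + j < n then (x : ℕ) + j else x + j - n,
          if j ≤ (x : ℕ) then (x : ℕ) - j else x + n - j} := by
      intro k hk
      simp only [mem_image, mem_filter, mem_univ, true_and] at hk
      obtain ⟨y, hy, rfl⟩ := hk
      have := y.isLt
      simp only [cycDist] at hy
      simp only [mem_insert, mem_singleton]
      split_ifs <;> omega
    rw [← Finset.card_image_of_injective _ Fin.val_injective]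
    exact (Finset.card_le_card h).trans Finset.card_le_two

lemma le_card_cycDist (n : ℕ) (x : Fin n) (j : ℕ) (hj : 2 * j < n) :
    cycSphere j ≤ #{y | cycDist n x y = j} := by
  have hx := x.isLt
  unfold cycSphere
  split_ifs with h0
  · refine Finset.card_pos.2 ⟨x, ?_⟩
    simp [cycDist, h0]
  · let p : Fin n := ⟨if (x : ℕ) + j < n then (x : ℕ) + j else x + j - n, by split_ifs <;> omega⟩
    let q : Fin n := ⟨if j ≤ (x : ℕ) then (x : ℕ) - j else x + n - j, by split_ifs <;> omega⟩
    have hpq : p ≠ q := by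
      simp only [p, q, ne_eq, Fin.mk.injEq]
      split_ifs <;> omega
    rw [← Finset.card_pair hpq]
    refine Finset.card_le_card fun y hy => ?_
    simp only [mem_insert, mem_singleton] at hy
    simp only [mem_filter, mem_univ, true_and]
    unfold cycDist
    rcases hy with rfl | rfl
    · simp only [p]; split_ifs <;> omega
    · simp only [q]; split_ifs <;> omega

lemma card_tdist (n : ℕ) (u : Vx n) (i : ℕ) :
    #{w | tdist n u w = i} =
      ∑ p ∈ antidiagonal i, #{y | cycDist n u.1 y = p.1} * #{y | cycDist n u.2 y = p.2} := by
  rw [Finset.card_eq_sum_card_fiberwise (t := antidiagonal i)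
    (f := fun w => (cycDist n u.1 w.1, cycDist n u.2 w.2))]
  · refine Finset.sum_congr rfl fun p hp => ?_
    rw [← Finset.card_product]
    congr 1
    ext w
    rw [HasAntidiagonal.mem_antidiagonal] at hp
    simp only [mem_filter, mem_univ, true_and, mem_product, Prod.ext_iff]
    rw [tdist_eq]
    omega
  · intro w hw
    have hw' : tdist n u w = i := by simpa using hw
    simpa [tdist_eq] using hw'

lemma sum_antidiagonal_cycSphere (k : ℕ) :
    ∑ p ∈ antidiagonal (k + 1), cycSphere p.1 * cycSphere p.2 = 4 * (k + 1) := by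
  have h : ∀ m : ℕ, ∑ p ∈ antidiagonal m, cycSphere p.2 = 2 * m + 1 := by
    intro m
    induction m with
    | zero => simp [cycSphere]
    | succ m ih =>
      rw [Finset.Nat.sum_antidiagonal_succ, ih]
      simp [cycSphere]; ring
  rw [Finset.Nat.sum_antidiagonal_succ]
  have h2 : ∀ p : ℕ × ℕ, cycSphere (p.1 + 1) * cycSphere p.2 = 2 * cycSphere p.2 := by
    intro p; simp [cycSphere]
  simp only [h2, ← Finset.mul_sum, h]
  simp [cycSphere]; ring

lemma card_tdist_le (n : ℕ) (u : Vx n) (k : ℕ) :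
    #{w | tdist n u w = k + 1} ≤ 4 * (k + 1) := by
  rw [card_tdist, ← sum_antidiagonal_cycSphere]
  exact Finset.sum_le_sum fun p _ =>
    Nat.mul_le_mul (card_cycDist_le n _ _) (card_cycDist_le n _ _)

lemma le_card_tdist (n : ℕ) (u : Vx n) (k : ℕ) (hk : 2 * (k + 1) < n) :
    4 * (k + 1) ≤ #{w | tdist n u w = k + 1} := by
  rw [card_tdist, ← sum_antidiagonal_cycSphere]
  refine Finset.sum_le_sum fun p hp => ?_
  rw [HasAntidiagonal.mem_antidiagonal] at hp
  exact Nat.mul_le_mul (le_card_cycDist n _ _ (by omega)) (le_card_cycDist n _ _ (by omega))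

/-! ### Sums of radial functions -/

lemma sum_radial (n : ℕ) (u : Vx n) (h : ℕ → ℝ) (h0 : h 0 = 0) :
    ∑ w, h (tdist n u w) = ∑ k ∈ range n, (#{w | tdist n u w = k + 1} : ℝ) * h (k + 1) := by
  have hmaps : ∀ w ∈ (univ : Finset (Vx n)), tdist n u w ∈ range (n + 1) := fun w _ =>
    mem_range.2 (Nat.lt_succ_of_le (tdist_le n u w))
  rw [← Finset.sum_fiberwise_of_maps_to hmaps, Finset.sum_range_succ']
  have hfib : ∀ i, ∑ w with tdist n u w = i, h (tdist n u w) =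
      (#{w | tdist n u w = i} : ℝ) * h i := by
    intro i
    rw [← nsmul_eq_mul, ← Finset.sum_const]
    exact Finset.sum_congr rfl fun w hw => by rw [(mem_filter.1 hw).2]
  simp only [hfib, h0, mul_zero, add_zero]

/-- The unnormalised weight `d(u,v)⁻²`, which vanishes on the diagonal. -/
noncomputable def weight (n : ℕ) (u v : Vx n) : ℝ := ((tdist n u v : ℝ) ^ 2)⁻¹

lemma weight_nonneg (n : ℕ) (u v : Vx n) : 0 ≤ weight n u v := by
  unfold weight; positivity

lemma weight_comm (n : ℕ) (u v : Vx n) : weight n u v = weight n v u := by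
  rw [weight, weight, tdist_comm]

lemma weight_self (n : ℕ) (u : Vx n) : weight n u u = 0 := by
  simp [weight, tdist_self]

lemma sum_weight_le (n : ℕ) (u : Vx n) :
    ∑ w, weight n u w ≤ 4 * (Real.log n + 1) := by
  have hrad := sum_radial n u (fun i => ((i : ℝ) ^ 2)⁻¹) (by simp)
  have hharm := harmonic_le_one_add_log n
  simp only [weight]
  rw [hrad]
  calc _ ≤ ∑ k ∈ range n, 4 * ((k : ℝ) + 1)⁻¹ := by
        refine Finset.sum_le_sum fun k _ => ?_
        have hc : (#{w | tdist n u w = k + 1} : ℝ) ≤ 4 * (k + 1) := by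
          exact_mod_cast card_tdist_le n u k
        calc _ ≤ 4 * ((k : ℝ) + 1) * (((k + 1 : ℕ) : ℝ) ^ 2)⁻¹ := by gcongr
          _ = 4 * ((k : ℝ) + 1)⁻¹ := by push_cast; field_simp
    _ = 4 * (harmonic n : ℝ) := by rw [← Finset.mul_sum]; simp [harmonic]
    _ ≤ _ := by linarith

lemma summable_zeta3 : Summable fun i : ℕ => ((i + 1 : ℝ) ^ 3)⁻¹ := by
  have h := (summable_nat_add_iff 1).2 (Real.summable_nat_pow_inv.2 (by norm_num : 1 < 3))
  simpa using h

lemma zeta3_pos : 0 < zeta3 :=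
  summable_zeta3.tsum_pos (fun i => by positivity) 0 (by norm_num)

lemma sum_weight_sq_le (n : ℕ) (u : Vx n) : ∑ w, weight n u w ^ 2 ≤ 4 * zeta3 := by
  have hrad := sum_radial n u (fun i => ((i : ℝ) ^ 2)⁻¹ ^ 2) (by simp)
  simp only [weight]
  rw [hrad]
  calc _ ≤ ∑ k ∈ range n, 4 * (((k : ℝ) + 1) ^ 3)⁻¹ := by
        refine Finset.sum_le_sum fun k _ => ?_
        have hc : (#{w | tdist n u w = k + 1} : ℝ) ≤ 4 * (k + 1) := by
          exact_mod_cast card_tdist_le n u k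
        calc _ ≤ 4 * ((k : ℝ) + 1) * (((k + 1 : ℕ) : ℝ) ^ 2)⁻¹ ^ 2 := by gcongr
          _ = 4 * (((k : ℝ) + 1) ^ 3)⁻¹ := by push_cast; field_simp
    _ ≤ 4 * zeta3 := by
        rw [← Finset.mul_sum]
        gcongr
        exact summable_zeta3.sum_le_tsum _ fun i _ => by positivity

lemma log_half_le_sum_weight (n : ℕ) (hn : 3 ≤ n) (u : Vx n) :
    4 * Real.log ((n : ℝ) / 2) ≤ ∑ w, weight n u w := by
  have hrad := sum_radial n u (fun i => ((i : ℝ) ^ 2)⁻¹) (by simp)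
  have hharm := log_add_one_le_harmonic ((n - 1) / 2)
  have hlog : Real.log ((n : ℝ) / 2) ≤ Real.log (((n - 1) / 2 + 1 : ℕ) : ℝ) := by
    have h : n ≤ 2 * ((n - 1) / 2 + 1) := by omega
    have h' : (n : ℝ) ≤ 2 * (((n - 1) / 2 + 1 : ℕ) : ℝ) := by exact_mod_cast h
    have : (3 : ℝ) ≤ n := by exact_mod_cast hn
    exact Real.log_le_log (by linarith) (by linarith)
  simp only [weight]
  rw [hrad]
  calc _ ≤ 4 * (harmonic ((n - 1) / 2) : ℝ) := by linarith
    _ = ∑ k ∈ range ((n - 1) / 2), 4 * ((k : ℝ) + 1)⁻¹ := by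
        rw [← Finset.mul_sum]; simp [harmonic]
    _ ≤ ∑ k ∈ range ((n - 1) / 2),
          (#{w | tdist n u w = k + 1} : ℝ) * (((k + 1 : ℕ) : ℝ) ^ 2)⁻¹ := by
        refine Finset.sum_le_sum fun k hk => ?_
        rw [mem_range] at hk
        have hc : 4 * ((k : ℝ) + 1) ≤ (#{w | tdist n u w = k + 1} : ℝ) := by
          exact_mod_cast le_card_tdist n u k (by omega)
        calc 4 * ((k : ℝ) + 1)⁻¹ = 4 * ((k : ℝ) + 1) * (((k + 1 : ℕ) : ℝ) ^ 2)⁻¹ := by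
              push_cast; field_simp
          _ ≤ _ := by gcongr
    _ ≤ _ := Finset.sum_le_sum_of_subset_of_nonneg
        (Finset.range_mono (by omega)) fun k _ _ => by positivity

/-! ### The transition probabilities -/

lemma sum_ne_weight (n : ℕ) (u : Vx n) :
    ∑ w ∈ univ.filter (fun w => w ≠ u), ((tdist n u w : ℝ) ^ 2)⁻¹ = ∑ w, weight n u w := by
  refine Finset.sum_subset (Finset.filter_subset _ _) fun w _ hw => ?_
  have : w = u := by simpa using hw
  subst this
  exact weight_self n w

lemma Zfac_eq (n : ℕ) (u : Vx n) : Zfac n u = (∑ w, weight n u w)⁻¹ := by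
  rw [Zfac, sum_ne_weight]

lemma mass_eq (n : ℕ) (c : Vx n → Vx n) :
    mass n c = ∏ u, Zfac n u * weight n u (c u) := by
  refine Finset.prod_congr rfl fun u _ => ?_
  split_ifs with h
  · rw [h, weight_self, mul_zero]
  · rfl

lemma log_half_pos (n : ℕ) (hn : 3 ≤ n) : 0 < Real.log ((n : ℝ) / 2) := by
  have : (3 : ℝ) ≤ n := by exact_mod_cast hn
  exact Real.log_pos (by linarith)

lemma Zfac_nonneg (n : ℕ) (u : Vx n) : 0 ≤ Zfac n u := by
  rw [Zfac_eq]
  exact inv_nonneg.2 (Finset.sum_nonneg fun w _ => weight_nonneg n u w)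

lemma Zfac_le (n : ℕ) (hn : 3 ≤ n) (u : Vx n) :
    Zfac n u ≤ (4 * Real.log ((n : ℝ) / 2))⁻¹ := by
  rw [Zfac_eq]
  exact inv_anti₀ (by linarith [log_half_pos n hn]) (log_half_le_sum_weight n hn u)

lemma sum_prob_eq_one (n : ℕ) (hn : 3 ≤ n) (u : Vx n) :
    ∑ v, Zfac n u * weight n u v = 1 := by
  rw [← Finset.mul_sum, Zfac_eq]
  exact inv_mul_cancel₀ (by linarith [log_half_pos n hn, log_half_le_sum_weight n hn u])

/-- In a product of probability vectors, prescribing the coordinates in `s` has probability the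
product of the corresponding masses. -/
lemma sum_prescribed {ι α : Type*} [Fintype ι] [DecidableEq ι] [Fintype α] (P : ι → α → ℝ)
    (hP : ∀ i, ∑ v, P i v = 1) (s : Finset ι) (g : ι → α) :
    ∑ c : ι → α, (if ∀ x ∈ s, c x = g x then ∏ i, P i (c i) else 0) = ∏ x ∈ s, P x (g x) := by
  have h1 : ∀ c : ι → α, (if ∀ x ∈ s, c x = g x then ∏ i, P i (c i) else 0) =
      ∏ i, if i ∈ s → c i = g i then P i (c i) else 0 := by
    intro c
    split_ifs with h
    · exact Finset.prod_congr rfl fun i _ => (if_pos (h i)).symm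
    · push Not at h
      obtain ⟨x, hx, hne⟩ := h
      exact (Finset.prod_eq_zero (mem_univ x) (if_neg fun h => hne (h hx))).symm
  simp only [h1]
  rw [← Fintype.piFinset_univ,
    ← Finset.prod_univ_sum (fun _ => univ) fun i v => if i ∈ s → v = g i then P i v else 0]
  have h2 : ∀ i, ∑ v, (if i ∈ s → v = g i then P i v else 0) =
      if i ∈ s then P i (g i) else 1 := by
    intro i
    by_cases hi : i ∈ s <;> simp [hi, hP]
  simp only [h2]
  simp

/-! ### Directed four-cycles of long-range choices -/

/-- `u → a → b → e → u` is a directed cycle of the choice function `c`. -/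
def IsDirectedCycle {V : Type*} (c : V → V) (u a b e : V) : Prop :=
  c u = a ∧ c a = b ∧ c b = e ∧ c e = u

/-- The vertices `u, a, b, e` are pairwise distinct. -/
def Distinct4 {V : Type*} (u a b e : V) : Prop :=
  a ≠ b ∧ a ≠ e ∧ b ≠ e ∧ a ≠ u ∧ b ≠ u ∧ e ≠ u

lemma choice_of_edgeKind_true {n : ℕ} {c : Vx n → Vx n} {x y : Vx n}
    (h : edgeKind n c x y true) : c x = y ∨ c y = x := by
  obtain ⟨⟨_, h1⟩, h2⟩ := h
  simp only [Bool.true_eq_false, iff_false] at h2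
  exact h1.resolve_left h2

/-- Four long-range edges on four vertices use all four choices, so they are consistently
oriented; reversing the labelling we may assume the orientation is the positive one. -/
lemma exists_isDirectedCycle {n : ℕ} {c : Vx n → Vx n} {u : Vx n}
    (h : cyclePat n c u true true true true) :
    ∃ a b e, Distinct4 u a b e ∧ IsDirectedCycle c u a b e := by
  obtain ⟨a, b, e, hab, hae, hbe, hau, hbu, heu, h1, h2, h3, h4⟩ := h
  have h1 := choice_of_edgeKind_true h1
  have h2 := choice_of_edgeKind_true h2
  have h3 := choice_of_edgeKind_true h3
  have h4 := choice_of_edgeKind_true h4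
  have key : IsDirectedCycle c u a b e ∨ IsDirectedCycle c u e b a := by
    unfold IsDirectedCycle
    grind
  rcases key with hc | hc
  · exact ⟨a, b, e, ⟨hab, hae, hbe, hau, hbu, heu⟩, hc⟩
  · exact ⟨e, b, a, ⟨hbe.symm, hae.symm, hab.symm, heu, hbu, hau⟩, hc⟩

lemma sum_mass_isDirectedCycle (n : ℕ) (hn : 3 ≤ n) {u a b e : Vx n} (h : Distinct4 u a b e) :
    ∑ c : Vx n → Vx n, (if IsDirectedCycle c u a b e then mass n c else 0) =
      (Zfac n u * weight n u a) * ((Zfac n a * weight n a b) *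
        ((Zfac n b * weight n b e) * (Zfac n e * weight n e u))) := by
  obtain ⟨hab, hae, hbe, hau, hbu, heu⟩ := h
  have hs := sum_prescribed (fun x v => Zfac n x * weight n x v) (sum_prob_eq_one n hn)
    {u, a, b, e} (fun x => if x = u then a else if x = a then b else if x = b then e else u)
  rw [Finset.prod_insert (by simp [hau.symm, hbu.symm, heu.symm]),
    Finset.prod_insert (by simp [hab, hae]), Finset.prod_insert (by simp [hbe]),
    Finset.prod_singleton] at hs
  simp only [hau, hbu, heu, hab.symm, hae.symm, hbe.symm, if_true, if_false] at hs
  rw [← hs]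
  refine Finset.sum_congr rfl fun c _ => ?_
  rw [mass_eq]
  congr 1
  simp [IsDirectedCycle, hau, hbu, heu, hab.symm, hae.symm, hbe.symm]

lemma mass_nonneg (n : ℕ) (c : Vx n → Vx n) : 0 ≤ mass n c := by
  rw [mass_eq]
  exact Finset.prod_nonneg fun u _ => mul_nonneg (Zfac_nonneg n u) (weight_nonneg n _ _)

/-- Union bound over the directed cycles through `u`. -/
lemma Pr_cyclePat_le (n : ℕ) (u : Vx n) :
    Pr n {c | cyclePat n c u true true true true} ≤
      ∑ a, ∑ b, ∑ e, if Distinct4 u a b e then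
        ∑ c : Vx n → Vx n, (if IsDirectedCycle c u a b e then mass n c else 0) else 0 := by
  let t : Finset (Vx n × Vx n × Vx n) := {q | Distinct4 u q.1 q.2.1 q.2.2}
  have hrhs : (∑ a, ∑ b, ∑ e, if Distinct4 u a b e then
        ∑ c : Vx n → Vx n, (if IsDirectedCycle c u a b e then mass n c else 0) else 0) =
      ∑ q ∈ t, ∑ c : Vx n → Vx n,
        (if IsDirectedCycle c u q.1 q.2.1 q.2.2 then mass n c else 0) := by
    rw [Finset.sum_filter, Fintype.sum_prod_type]
    simp only [Fintype.sum_prod_type]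
  rw [hrhs, Finset.sum_comm, Pr]
  refine Finset.sum_le_sum fun c _ => ?_
  have hnn : ∀ q ∈ t, 0 ≤ if IsDirectedCycle c u q.1 q.2.1 q.2.2 then mass n c else 0 := by
    intro q _
    split_ifs
    exacts [mass_nonneg n c, le_rfl]
  split_ifs with h
  · obtain ⟨a, b, e, hd, hc⟩ := exists_isDirectedCycle h
    have hle := Finset.single_le_sum hnn (show (a, b, e) ∈ t by simp [t, hd])
    simpa only [if_pos hc] using hle
  · exact Finset.sum_nonneg hnn

/-- The sum of the weights of all closed walks of length four through `u`. -/
lemma sum_weight_cycle_le (n : ℕ) (u : Vx n) :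
    ∑ a, ∑ b, ∑ e, weight n u a * (weight n a b * (weight n b e * weight n e u)) ≤
      64 * zeta3 * (Real.log n + 1) ^ 2 := by
  set L : ℝ := 4 * (Real.log n + 1) with hL
  have hL0 : 0 ≤ L := (Finset.sum_nonneg fun w _ => weight_nonneg n u w).trans (sum_weight_le n u)
  have hpath : ∑ a, ∑ b, ∑ e, weight n u a ^ 2 * (weight n a b * weight n b e) ≤
      4 * zeta3 * L ^ 2 := by
    calc _ = ∑ a, weight n u a ^ 2 * ∑ b, weight n a b * ∑ e, weight n b e := by
          simp only [Finset.mul_sum]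
      _ ≤ ∑ a, weight n u a ^ 2 * ∑ b, weight n a b * L := by
          gcongr with a _ b _
          · exact weight_nonneg n a b
          · exact sum_weight_le n b
      _ = ∑ a, weight n u a ^ 2 * ((∑ b, weight n a b) * L) := by
          simp only [Finset.sum_mul]
      _ ≤ ∑ a, weight n u a ^ 2 * (L * L) := by
          gcongr with a _
          exact sum_weight_le n a
      _ = (∑ a, weight n u a ^ 2) * L ^ 2 := by rw [← Finset.sum_mul, sq L]
      _ ≤ _ := by gcongr; exact sum_weight_sq_le n u
  have hswap : ∑ a, ∑ b, ∑ e, weight n u e ^ 2 * (weight n e b * weight n b a) =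
      ∑ a, ∑ b, ∑ e, weight n u a ^ 2 * (weight n a b * weight n b e) := by
    rw [Finset.sum_comm]
    conv_lhs => enter [2, b]; rw [Finset.sum_comm]
    rw [Finset.sum_comm]
  calc _ ≤ ∑ a, ∑ b, ∑ e, (2⁻¹ * (weight n u a ^ 2 * (weight n a b * weight n b e)) +
          2⁻¹ * (weight n u e ^ 2 * (weight n e b * weight n b a))) := by
        gcongr with a _ b _ e _
        rw [weight_comm n e u, weight_comm n e b, weight_comm n b a]
        have h := mul_nonneg (weight_nonneg n a b) (weight_nonneg n b e)
        nlinarith [mul_nonneg h (sq_nonneg (weight n u a - weight n u e))]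
    _ = ∑ a, ∑ b, ∑ e, weight n u a ^ 2 * (weight n a b * weight n b e) := by
        simp only [Finset.sum_add_distrib, ← Finset.mul_sum, hswap]
        ring
    _ ≤ _ := hpath
    _ = _ := by rw [hL]; ring

end TorusSmallWorld

open TorusSmallWorld in
/-- Probability bound for the event `E9ᵤ`. -/
theorem prob_E9 :
    ∀ n : ℕ, 3 ≤ n → ∀ u : Vx n,
      Pr n {c | cyclePat n c u true true true true} <
        ((3 / 4) * zeta3 + 1 / 4) * (Real.log (n : ℝ) + 1) ^ 2 * (Real.log ((n : ℝ) / 2) ^ 4)⁻¹ := by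
  intro n hn u
  have hlog := log_half_pos n hn
  have hn1 : (1 : ℝ) ≤ n := by exact_mod_cast (by omega : 1 ≤ n)
  have hlogn : 0 ≤ Real.log n := Real.log_nonneg hn1
  set K : ℝ := (4 * Real.log ((n : ℝ) / 2))⁻¹ with hK
  have hK0 : 0 ≤ K := by positivity
  have hp : ∀ x y, 0 ≤ Zfac n x * weight n x y := fun x y =>
    mul_nonneg (Zfac_nonneg n x) (weight_nonneg n x y)
  have hw := weight_nonneg n
  calc _ ≤ ∑ a, ∑ b, ∑ e,
          K ^ 4 * (weight n u a * (weight n a b * (weight n b e * weight n e u))) := by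
        refine (Pr_cyclePat_le n u).trans ?_
        gcongr with a _ b _ e _
        split_ifs with hd
        · rw [sum_mass_isDirectedCycle n hn hd]
          calc _ ≤ (K * weight n u a) * ((K * weight n a b) *
                ((K * weight n b e) * (K * weight n e u))) := by
                have h1 := hw u a
                have h2 := hw a b
                have h3 := hw b e
                have h4 := hw e u
                have h5 := hp a b
                have h6 := hp b e
                have h7 := hp e u
                gcongr <;> exact Zfac_le n hn _
            _ = _ := by ring
        · have h1 := hw u a
          have h2 := hw a b
          have h3 := hw b e
          have h4 := hw e u
          positivity
    _ = K ^ 4 * ∑ a, ∑ b, ∑ e,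
          weight n u a * (weight n a b * (weight n b e * weight n e u)) := by
        simp only [Finset.mul_sum]
    _ ≤ K ^ 4 * (64 * zeta3 * (Real.log n + 1) ^ 2) := by
        gcongr
        exact sum_weight_cycle_le n u
    _ = (1 / 4 * zeta3) * (Real.log n + 1) ^ 2 * (Real.log ((n : ℝ) / 2) ^ 4)⁻¹ := by
        rw [hK]; field_simp; norm_num
    _ < _ := by
        have hz := zeta3_pos
        gcongr ?_ * _ * _
        linarith
end
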